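/- arXiv:2510.17371 — 5 statements merged into one kernel-verified Lean document; each statement's English description precedes it below -/
import Mathlib

section
/- Let n, p be positive integers, c₁, c₂ > 0, and θ ∈ ℝᵖ. Let V : ℝⁿ × ℝᵖ → ℝ be smooth (infinitely differentiable) with c₁‖x‖₂² ≤ V(x,θ) ≤ c₂‖x‖₂² for all x ∈ ℝⁿ, and let Δ : ℝⁿ → ℝ^{p×n} be twice continuously differentiable with Δ(0) = 0. Then for every r > 0, lim_{x→0, x≠0} V(x,θ)^{1/r−1} Δ(x) ∇ₓV(x,θ) = 0 (limit taken in ℝᵖ). In particular, lim_{x→0} ‖V(x,θ)^{1/r−1} Δ(x) ∇ₓV(x,θ)‖_∞ < ∞ for every r > 0, i.e., the vanishing degree vd(Δ,V) is infinite. -/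
open Matrix Filter Topology

open Asymptotics

/-- A function differentiable at the origin and vanishing there is `O(‖x‖)`. -/
lemma DifferentiableAt.isBigO_norm_of_map_zero {E F : Type*} [NormedAddCommGroup E]
    [NormedSpace ℝ E] [NormedAddCommGroup F] [NormedSpace ℝ F] {f : E → F}
    (hf : DifferentiableAt ℝ f 0) (h0 : f 0 = 0) : f =O[𝓝 0] fun x => ‖x‖ := by
  simpa [h0] using hf.isBigO_sub.norm_right

lemma norm_sq_le_sum_sq {n : ℕ} (x : Fin n → ℝ) : ‖x‖ ^ 2 ≤ ∑ i, x i ^ 2 := by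
  have hS : 0 ≤ ∑ i, x i ^ 2 := Finset.sum_nonneg fun i _ => sq_nonneg _
  have h : ‖x‖ ≤ √(∑ i, x i ^ 2) := by
    refine (pi_norm_le_iff_of_nonneg (Real.sqrt_nonneg _)).2 fun i => Real.abs_le_sqrt ?_
    exact Finset.single_le_sum (f := fun i => x i ^ 2) (fun i _ => sq_nonneg _)
      (Finset.mem_univ i)
  exact (Real.le_sqrt (norm_nonneg _) hS).1 h

/-- Theorem 2 (computing the vanishing degree): if `V` is smooth with
`c₁‖x‖² ≤ V(x,θ) ≤ c₂‖x‖²` and the regressor `Δ ∈ C²` vanishes at the origin, then for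
every `r > 0` the quantity `V(x,θ)^{1/r-1} Δ(x) ∇ₓV(x,θ)` tends to `0` as `x → 0`, `x ≠ 0`;
in particular its (sup-)norm has a finite limit, i.e. the vanishing degree is infinite. -/
theorem vanishing_degree_infinite
    {n p : ℕ} (hn : 0 < n) (hp : 0 < p)
    (c₁ c₂ : ℝ) (hc₁ : 0 < c₁) (hc₂ : 0 < c₂)
    (θ : Fin p → ℝ)
    (V : (Fin n → ℝ) → (Fin p → ℝ) → ℝ)
    (hV : ContDiff ℝ (⊤ : ℕ∞) (fun q : (Fin n → ℝ) × (Fin p → ℝ) => V q.1 q.2))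
    (hVbound : ∀ x : Fin n → ℝ, c₁ * (∑ i, x i ^ 2) ≤ V x θ ∧ V x θ ≤ c₂ * (∑ i, x i ^ 2))
    (gx : (Fin n → ℝ) → (Fin p → ℝ) → (Fin n → ℝ))
    (hgx : ∀ (x : Fin n → ℝ) (ϑ : Fin p → ℝ) (v : Fin n → ℝ),
      fderiv ℝ (fun y => V y ϑ) x v = gx x ϑ ⬝ᵥ v)
    (Δ : (Fin n → ℝ) → Matrix (Fin p) (Fin n) ℝ)
    (hΔ : ∀ i j, ContDiff ℝ 2 (fun x : Fin n → ℝ => Δ x i j))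
    (hΔ0 : Δ 0 = 0) :
    ∀ r : ℝ, 0 < r →
      Tendsto (fun x : Fin n → ℝ => (V x θ ^ (1/r - 1 : ℝ)) • (Δ x).mulVec (gx x θ))
        (𝓝[≠] 0) (𝓝 0) ∧
      ∃ L : ℝ, Tendsto (fun x : Fin n → ℝ =>
          ‖(V x θ ^ (1/r - 1 : ℝ)) • (Δ x).mulVec (gx x θ)‖) (𝓝[≠] 0) (𝓝 L) := by
  intro r hr
  suffices h : Tendsto (fun x : Fin n → ℝ => (V x θ ^ (1/r - 1 : ℝ)) • (Δ x).mulVec (gx x θ))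
      (𝓝[≠] 0) (𝓝 0) from ⟨h, 0, by simpa using h.norm⟩
  have hf : ContDiff ℝ 2 (fun y => V y θ) :=
    (contDiff_infty.1 hV 2).comp (contDiff_id.prodMk contDiff_const)
  have hV0 : V 0 θ = 0 := by
    have := hVbound 0
    simp at this
    linarith
  have hlow (x : Fin n → ℝ) : c₁ * ‖x‖ ^ 2 ≤ V x θ :=
    (mul_le_mul_of_nonneg_left (norm_sq_le_sum_sq x) hc₁.le).trans (hVbound x).1
  have hgrad0 : fderiv ℝ (fun y => V y θ) 0 = 0 := by
    refine IsLocalMin.fderiv_eq_zero (Eventually.of_forall fun x => ?_)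
    simp only [hV0]
    exact (by positivity : 0 ≤ c₁ * ‖x‖ ^ 2).trans (hlow x)
  have hg (j : Fin n) : (fun x => gx x θ j) =O[𝓝 0] fun x => ‖x‖ := by
    have heq : (fun x => gx x θ j) =
        fun x => fderiv ℝ (fun y => V y θ) x (Pi.single j 1) := by
      ext x
      simp [hgx]
    rw [heq]
    refine DifferentiableAt.isBigO_norm_of_map_zero ?_ (by simp [hgrad0])
    have hd : Differentiable ℝ (fderiv ℝ (fun y => V y θ)) :=
      (hf.fderiv_right (m := 1) (by norm_num)).differentiable (by norm_num)
    exact (hd 0).clm_apply (differentiableAt_const _)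
  have hΔO (i : Fin p) (j : Fin n) : (fun x => Δ x i j) =O[𝓝 0] fun x => ‖x‖ :=
    (((hΔ i j).differentiable (by norm_num)) 0).isBigO_norm_of_map_zero (by simp [hΔ0])
  have hnV : (fun x : Fin n → ℝ => ‖x‖ * ‖x‖) =O[𝓝 0] fun x => V x θ := by
    refine IsBigO.of_bound c₁⁻¹ (Eventually.of_forall fun x => ?_)
    rw [← pow_two, Real.norm_of_nonneg (by positivity), inv_mul_eq_div, le_div_iff₀' hc₁]
    exact (hlow x).trans (le_abs_self _)
  have hmul (i : Fin p) : (fun x => (Δ x).mulVec (gx x θ) i) =O[𝓝 0] fun x => V x θ := by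
    simp only [Matrix.mulVec, dotProduct]
    exact (IsBigO.fun_sum fun j _ => (hΔO i j).mul (hg j)).trans hnV
  have hpow : Tendsto (fun x => V x θ ^ (1/r : ℝ)) (𝓝[≠] 0) (𝓝 0) := by
    have hc : ContinuousAt (fun x => V x θ ^ (1/r : ℝ)) 0 :=
      hf.continuous.continuousAt.rpow_const (Or.inr (by positivity))
    have := hc.tendsto
    rw [hV0, Real.zero_rpow (by positivity)] at this
    exact this.mono_left nhdsWithin_le_nhds
  rw [tendsto_pi_nhds]
  intro i
  refine IsBigO.trans_tendsto ?_ hpow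
  have hprod := (isBigO_refl (fun x => V x θ ^ (1/r - 1 : ℝ)) (𝓝[≠] 0)).mul
    ((hmul i).mono nhdsWithin_le_nhds)
  refine hprod.congr' (Eventually.of_forall fun x => rfl) ?_
  filter_upwards [self_mem_nhdsWithin] with x hx
  have hpos : 0 < V x θ := by
    have := norm_pos_iff.2 hx
    exact (by positivity : 0 < c₁ * ‖x‖ ^ 2).trans_le (hlow x)
  rw [← Real.rpow_add_one hpos.ne', sub_add_cancel]
end

section
/- Let γ > 0, r ≥ 1 and θ ∈ ℝ. Let x, θ̂ : [0,∞) → ℝ be differentiable functions satisfying, for all t ≥ 0: x'(t) = −(1/2)x(t) − (θ̂(t) − θ)|x(t)| and θ̂'(t) = γ sign(x(t)) (x(t)² + |x(t)|^{2/r}). Then x and θ̂ are bounded on [0,∞), the function t ↦ |x(t)|^{2/r} is integrable on [0,∞), and x(t) → 0 as t → ∞. -/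
open MeasureTheory Set Filter

/-- A differentiable function with `|f'| ≤ K |f|` on `[0, T]` which vanishes somewhere on `[0, T]`
vanishes on all of `[0, T]`. -/
theorem eq_zero_of_abs_deriv_le_mul_abs {f f' : ℝ → ℝ} {K T s t : ℝ}
    (hf : ∀ u ∈ Icc 0 T, HasDerivAt f (f' u) u)
    (hK : ∀ u ∈ Icc 0 T, |f' u| ≤ K * |f u|)
    (hs : s ∈ Icc 0 T) (ht : t ∈ Icc 0 T) (h0 : f s = 0) : f t = 0 := by
  have hder : ∀ c : ℝ, ∀ u ∈ Icc 0 T, HasDerivAt (fun u => f u ^ 2 * Real.exp (c * u))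
      ((2 * (f u * f' u) + c * f u ^ 2) * Real.exp (c * u)) u := by
    intro c u hu
    have h1 := ((hf u hu).fun_pow 2).fun_mul (((hasDerivAt_id u).const_mul c).exp)
    refine h1.congr_deriv ?_
    simp
    ring
  have hbound : ∀ u ∈ Icc 0 T, |f u * f' u| ≤ K * f u ^ 2 := by
    intro u hu
    rw [abs_mul, ← sq_abs (f u)]
    nlinarith [mul_le_mul_of_nonneg_left (hK u hu) (abs_nonneg (f u))]
  suffices h : f t ^ 2 ≤ 0 by
    exact pow_eq_zero_iff two_ne_zero |>.1 (le_antisymm h (sq_nonneg _))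
  rcases le_total s t with hst | hst
  · have hanti : AntitoneOn (fun u => f u ^ 2 * Real.exp (-(2 * K) * u)) (Icc 0 T) := by
      refine antitoneOn_of_hasDerivWithinAt_nonpos (convex_Icc 0 T)
        (fun u hu => (hder _ u hu).continuousAt.continuousWithinAt)
        (fun u hu => (hder _ u (interior_subset hu)).hasDerivWithinAt) fun u hu => ?_
      have := abs_le.1 (hbound u (interior_subset hu))
      exact mul_nonpos_of_nonpos_of_nonneg (by linarith) (Real.exp_pos _).le
    have h := hanti hs ht hst
    simp only [h0] at h
    exact nonpos_of_mul_nonpos_left (by simpa using h) (Real.exp_pos _)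
  · have hmono : MonotoneOn (fun u => f u ^ 2 * Real.exp (2 * K * u)) (Icc 0 T) := by
      refine monotoneOn_of_hasDerivWithinAt_nonneg (convex_Icc 0 T)
        (fun u hu => (hder _ u hu).continuousAt.continuousWithinAt)
        (fun u hu => (hder _ u (interior_subset hu)).hasDerivWithinAt) fun u hu => ?_
      have := abs_le.1 (hbound u (interior_subset hu))
      exact mul_nonneg (by linarith) (Real.exp_pos _).le
    have h := hmono ht hs hst
    simp only [h0] at h
    exact nonpos_of_mul_nonpos_left (by simpa using h) (Real.exp_pos _)

/-- A function with zero derivative on `[0, ∞)` is constant there. -/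
theorem eq_apply_zero_of_hasDerivAt_zero {f : ℝ → ℝ} (hf : ∀ t ≥ (0 : ℝ), HasDerivAt f 0 t)
    {t : ℝ} (ht : 0 ≤ t) : f t = f 0 :=
  constant_of_has_deriv_right_zero
    (fun u hu => (hf u hu.1).continuousAt.continuousWithinAt)
    (fun u hu => (hf u hu.1).hasDerivWithinAt) t ⟨ht, le_rfl⟩

/-- The system `y' = -(1/2 + w) y`, `w' = γ (y² + y^p)` on positive `y` has the first integral
`γ (y² / 2 + y^p / p) + (w + w²) / 2`, which makes `y` and `w` bounded, `y^p` integrable and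
`y` convergent to zero. -/
theorem bounded_integrable_tendsto_of_pos {γ p : ℝ} (hγ : 0 < γ) (hp : 0 < p) {y w : ℝ → ℝ}
    (hpos : ∀ t ≥ (0 : ℝ), 0 < y t)
    (hy : ∀ t ≥ (0 : ℝ), HasDerivAt y (-(1 / 2 + w t) * y t) t)
    (hw : ∀ t ≥ (0 : ℝ), HasDerivAt w (γ * (y t ^ 2 + y t ^ p)) t) :
    (∃ C, ∀ t ≥ (0 : ℝ), |y t| ≤ C) ∧ (∃ C, ∀ t ≥ (0 : ℝ), |w t| ≤ C) ∧
      IntegrableOn (fun t => y t ^ p) (Ici 0) ∧ Tendsto y atTop (nhds 0) := by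
  set E : ℝ → ℝ := fun t => γ * (y t ^ 2 / 2 + y t ^ p / p) + (w t + w t ^ 2) / 2 with hE
  have hE' : ∀ t ≥ (0 : ℝ), HasDerivAt E 0 t := by
    intro t ht
    have h1 := (((((hy t ht).fun_pow 2).div_const 2).fun_add
      (((hy t ht).rpow_const (p := p) (Or.inl (hpos t ht).ne')).div_const p)).const_mul γ).fun_add
      (((hw t ht).fun_add ((hw t ht).fun_pow 2)).div_const 2)
    refine h1.congr_deriv ?_
    rw [Real.rpow_sub_one (hpos t ht).ne']
    have := (hpos t ht).ne'
    field_simp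
    ring
  have hcons : ∀ t ≥ (0 : ℝ), E t = E 0 := fun t ht => eq_apply_zero_of_hasDerivAt_zero hE' ht
  have hpow : ∀ t ≥ (0 : ℝ), 0 < y t ^ p := fun t ht => Real.rpow_pos_of_pos (hpos t ht) p
  have hbd : ∀ t ≥ (0 : ℝ), γ * y t ^ 2 + (w t + 1 / 2) ^ 2 ≤ 2 * E 0 + 1 / 4 := by
    intro t ht
    have h1 := hcons t ht
    have h2 : 0 < γ * (y t ^ p / p) := mul_pos hγ (div_pos (hpow t ht) hp)
    rw [← h1]
    simp only [hE]
    nlinarith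
  set D := 2 * E 0 + 1 / 4
  have hwD : ∀ t ≥ (0 : ℝ), |w t + 1 / 2| ≤ √D := fun t ht =>
    Real.abs_le_sqrt (by nlinarith [hbd t ht, sq_nonneg (y t)])
  have hwb : ∀ t ≥ (0 : ℝ), |w t| ≤ √D + 1 / 2 := by
    intro t ht
    have := abs_le.1 (hwD t ht)
    exact abs_le.2 ⟨by linarith, by linarith⟩
  have hyb : ∀ t ≥ (0 : ℝ), |y t| ≤ √(D / γ) := fun t ht =>
    Real.abs_le_sqrt (by
      rw [le_div_iff₀ hγ]
      nlinarith [hbd t ht, sq_nonneg (w t + 1 / 2)])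
  have hw'nn : ∀ t ≥ (0 : ℝ), 0 ≤ γ * (y t ^ 2 + y t ^ p) := fun t ht =>
    mul_nonneg hγ.le (add_nonneg (sq_nonneg _) (hpow t ht).le)
  have hwmono : MonotoneOn w (Ici 0) :=
    monotoneOn_of_hasDerivWithinAt_nonneg (convex_Ici 0)
      (fun u hu => (hw u hu).continuousAt.continuousWithinAt)
      (fun u hu => (hw u (interior_subset hu)).hasDerivWithinAt)
      fun u hu => hw'nn u (interior_subset hu)
  have hw'int : IntegrableOn (fun t => γ * (y t ^ 2 + y t ^ p)) (Ioi 0) := by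
    have hm : Monotone fun t => w (max t 0) := fun a b hab =>
      hwmono (le_max_right a 0) (le_max_right b 0) (max_le_max_right 0 hab)
    have hb : BddAbove (range fun t => w (max t 0)) :=
      ⟨√D + 1 / 2, by
        rintro _ ⟨t, rfl⟩
        exact (le_abs_self _).trans (hwb _ (le_max_right t 0))⟩
    have hlim : Tendsto w atTop (nhds (⨆ t, w (max t 0))) := by
      refine (tendsto_atTop_ciSup hm hb).congr' ?_
      filter_upwards [eventually_ge_atTop (0 : ℝ)] with t ht
      rw [max_eq_left ht]
    exact integrableOn_Ioi_deriv_of_nonneg (hw 0 le_rfl).continuousAt.continuousWithinAt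
      (fun t ht => hw t (le_of_lt ht)) (fun t ht => hw'nn t (le_of_lt ht)) hlim
  have hyc : ContinuousOn y (Ioi 0) := fun t ht =>
    (hy t (le_of_lt ht)).continuousAt.continuousWithinAt
  have hwc : ContinuousOn w (Ioi 0) := fun t ht =>
    (hw t (le_of_lt ht)).continuousAt.continuousWithinAt
  have hsumint : IntegrableOn (fun t => y t ^ 2 + y t ^ p) (Ioi 0) := by
    refine (hw'int.const_mul γ⁻¹).congr (ae_of_all _ fun t => ?_)
    simp only
    rw [inv_mul_cancel_left₀ hγ.ne']
  have hpint : IntegrableOn (fun t => y t ^ p) (Ioi 0) := by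
    refine hsumint.mono' ((hyc.rpow_const fun t ht =>
      Or.inl (hpos t (le_of_lt ht)).ne').aestronglyMeasurable measurableSet_Ioi) ?_
    filter_upwards [ae_restrict_mem measurableSet_Ioi] with t ht
    rw [Real.norm_of_nonneg (hpow t (le_of_lt ht)).le]
    linarith [sq_nonneg (y t)]
  have hsqint : IntegrableOn (fun t => y t ^ 2) (Ioi 0) := by
    refine (hsumint.sub hpint).congr (ae_of_all _ fun t => ?_)
    simp
  have hsq'int : IntegrableOn (fun t => -2 * (w t + 1 / 2) * y t ^ 2) (Ioi 0) := by
    refine (hsqint.const_mul (2 * √D)).mono' ((((hwc.add continuousOn_const).const_smul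
      (-2 : ℝ)).mul (hyc.pow 2)).aestronglyMeasurable measurableSet_Ioi) ?_
    filter_upwards [ae_restrict_mem measurableSet_Ioi] with t ht
    rw [Real.norm_eq_abs, abs_mul, abs_mul, abs_of_nonneg (sq_nonneg (y t))]
    have := hwD t (le_of_lt ht)
    norm_num at this ⊢
    gcongr
  have hsq : Tendsto (fun t => y t ^ 2) atTop (nhds 0) := by
    refine tendsto_zero_of_hasDerivAt_of_integrableOn_Ioi (fun t ht => ?_) hsq'int hsqint
    refine ((hy t (le_of_lt ht)).fun_pow 2).congr_deriv ?_
    simp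
    ring
  refine ⟨⟨_, hyb⟩, ⟨_, hwb⟩, (integrableOn_Ici_iff_integrableOn_Ioi).2 hpint, ?_⟩
  have h := hsq.sqrt
  simp only [Real.sqrt_sq_eq_abs, Real.sqrt_zero] at h
  exact (tendsto_zero_iff_abs_tendsto_zero y).2 h

/-- Proposition 1: normalized estimation law for the scalar closed-loop system
`ẋ = -x/2 - (θ̂ - θ)|x|`, `θ̂' = γ sign(x)(x² + |x|^{2/r})`. -/
theorem normalized_estimation_scalar
    (γ r θ : ℝ) (hγ : 0 < γ) (hr : 1 ≤ r)
    (x θh : ℝ → ℝ)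
    (hx : ∀ t ≥ (0:ℝ), HasDerivAt x (-(1/2) * x t - (θh t - θ) * |x t|) t)
    (hθh : ∀ t ≥ (0:ℝ),
      HasDerivAt θh (γ * Real.sign (x t) * (x t ^ 2 + |x t| ^ (2/r : ℝ))) t) :
    (∃ C, ∀ t ≥ (0:ℝ), |x t| ≤ C) ∧
    (∃ C, ∀ t ≥ (0:ℝ), |θh t| ≤ C) ∧
    IntegrableOn (fun t => |x t| ^ (2/r : ℝ)) (Ici 0) ∧
    Tendsto x atTop (nhds 0) := by
  have hp : 0 < 2 / r := by positivity
  have hxc : ContinuousOn x (Ici 0) := fun t ht => (hx t ht).continuousAt.continuousWithinAt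
  have hθc : ContinuousOn θh (Ici 0) := fun t ht => (hθh t ht).continuousAt.continuousWithinAt
  by_cases hz : ∃ s ≥ (0 : ℝ), x s = 0
  · obtain ⟨s, hs, hs0⟩ := hz
    have hzero : ∀ t ≥ (0 : ℝ), x t = 0 := by
      intro t ht
      obtain ⟨C, hC⟩ := (isCompact_Icc (a := (0 : ℝ)) (b := max s t)).exists_bound_of_continuousOn
        ((hθc.sub (continuousOn_const (c := θ))).mono Icc_subset_Ici_self)
      refine eq_zero_of_abs_deriv_le_mul_abs (K := 1 / 2 + C) (T := max s t)
        (fun u hu => hx u hu.1) (fun u hu => ?_) ⟨hs, le_max_left _ _⟩ ⟨ht, le_max_right _ _⟩ hs0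
      have h1 : |θh u - θ| ≤ C := hC u hu
      calc |-(1 / 2) * x u - (θh u - θ) * (|x u|)|
          ≤ |-(1 / 2) * x u| + |(θh u - θ) * (|x u|)| := abs_sub _ _
        _ = 1 / 2 * |x u| + |θh u - θ| * |x u| := by
            rw [abs_mul, abs_mul, abs_abs]; norm_num
        _ ≤ (1 / 2 + C) * |x u| := by
            rw [add_mul]; gcongr
    have hθ0 : ∀ t ≥ (0 : ℝ), θh t = θh 0 := fun t ht =>
      eq_apply_zero_of_hasDerivAt_zero (fun u hu => by simpa [hzero u hu] using hθh u hu) ht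
    refine ⟨⟨0, fun t ht => by simp [hzero t ht]⟩, ⟨|θh 0|, fun t ht => by rw [hθ0 t ht]⟩, ?_, ?_⟩
    · refine integrableOn_zero.congr_fun (fun t ht => ?_) measurableSet_Ici
      simp [hzero t ht, Real.zero_rpow hp.ne']
    · refine tendsto_const_nhds.congr' ?_
      filter_upwards [eventually_ge_atTop (0 : ℝ)] with t ht
      rw [hzero t ht]
  push Not at hz
  have hsign : (∀ t ≥ (0 : ℝ), 0 < x t) ∨ ∀ t ≥ (0 : ℝ), x t < 0 := by
    by_contra! h
    obtain ⟨⟨a, ha, hxa⟩, b, hb, hxb⟩ := h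
    obtain ⟨s, hs, hs0⟩ := isPreconnected_Ici.intermediate_value ha hb hxc ⟨hxa, hxb⟩
    exact hz s hs hs0
  rcases hsign with hpos | hneg
  · obtain ⟨hxb, ⟨C, hC⟩, hxint, hlim⟩ := bounded_integrable_tendsto_of_pos (w := fun t => θh t - θ)
      hγ hp hpos
      (fun t ht => by
        refine (hx t ht).congr_deriv ?_
        rw [abs_of_pos (hpos t ht)]; ring)
      (fun t ht => by
        refine ((hθh t ht).sub_const θ).congr_deriv ?_
        rw [abs_of_pos (hpos t ht), Real.sign_of_pos (hpos t ht), mul_one])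
    refine ⟨hxb, ⟨C + |θ|, fun t ht => ?_⟩, hxint.congr_fun (fun t ht => ?_) measurableSet_Ici, hlim⟩
    · have := abs_add_le (θh t - θ) θ
      rw [sub_add_cancel] at this
      linarith [hC t ht]
    · simp only
      rw [abs_of_pos (hpos t ht)]
  · obtain ⟨⟨B, hB⟩, ⟨C, hC⟩, hxint, hlim⟩ := bounded_integrable_tendsto_of_pos
      (y := fun t => -x t) (w := fun t => -(θh t - θ)) hγ hp (fun t ht => neg_pos.2 (hneg t ht))
      (fun t ht => by
        refine ((hx t ht).fun_neg).congr_deriv ?_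
        rw [abs_of_neg (hneg t ht)]; ring)
      (fun t ht => by
        refine (((hθh t ht).sub_const θ).fun_neg).congr_deriv ?_
        rw [abs_of_neg (hneg t ht), Real.sign_of_neg (hneg t ht)]; ring)
    refine ⟨⟨B, fun t ht => by simpa using hB t ht⟩, ⟨C + |θ|, fun t ht => ?_⟩,
      hxint.congr_fun (fun t ht => ?_) measurableSet_Ici, by simpa using hlim.neg⟩
    · have := abs_add_le (θh t - θ) θ
      rw [sub_add_cancel] at this
      have h2 := hC t ht
      rw [abs_neg] at h2
      linarith
    · simp only
      rw [abs_of_neg (hneg t ht)]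
end

section
/- Let γ > 0, r ≥ 1 and θ ∈ ℝ. Let x, θ̂ : [0,∞) → ℝ be differentiable functions satisfying, for all t ≥ 0: x'(t) = −(1/2)x(t) − (θ̂(t) − θ)x(t)² and θ̂'(t) = γ (x(t)³ + x(t)|x(t)|^{2/r}). Then x and θ̂ are bounded on [0,∞), the function t ↦ |x(t)|^{2/r} is integrable on [0,∞), and x(t) → 0 as t → ∞. -/
open MeasureTheory Set Filter

/-- A solution of the scalar linear equation `ẋ = a x` on `[0, ∞)` with continuous `a` is
`x 0` times the exponential of an antiderivative of `a`. -/
lemma exists_primitive_eq_mul_exp {x a : ℝ → ℝ} (ha : ContinuousOn a (Ici 0))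
    (hx : ∀ t ≥ (0:ℝ), HasDerivAt x (a t * x t) t) :
    ∃ A : ℝ → ℝ, (∀ t ≥ (0:ℝ), HasDerivAt A (a t) t) ∧
      ∀ t ≥ (0:ℝ), x t = x 0 * Real.exp (A t) := by
  have hc : Continuous fun s => a (max 0 s) :=
    ha.comp_continuous (by fun_prop) fun s => le_max_left 0 s
  have hA : ∀ t ≥ (0:ℝ), HasDerivAt (fun t => ∫ s in (0:ℝ)..t, a (max 0 s)) (a t) t := by
    intro t ht
    have h := hc.integral_hasStrictDerivAt 0 t |>.hasDerivAt
    rwa [max_eq_right ht] at h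
  refine ⟨_, hA, fun t ht => ?_⟩
  set A : ℝ → ℝ := fun t => ∫ s in (0:ℝ)..t, a (max 0 s)
  have hy : ∀ s ≥ (0:ℝ), HasDerivAt (fun s => x s * Real.exp (-A s)) 0 s := by
    intro s hs
    refine ((hx s hs).mul (hA s hs).neg.exp).congr_deriv ?_
    simp only [Pi.neg_apply]
    ring
  have hconst := constant_of_has_deriv_right_zero (a := 0) (b := t)
    (fun s hs => (hy s hs.1).continuousAt.continuousWithinAt)
    (fun s hs => (hy s hs.1).hasDerivWithinAt) t ⟨ht, le_rfl⟩
  have hA0 : A 0 = 0 := intervalIntegral.integral_same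
  simp only [hA0, neg_zero, Real.exp_zero, mul_one] at hconst
  rw [← hconst, mul_assoc, ← Real.exp_add, neg_add_cancel, Real.exp_zero, mul_one]

/-- A nonnegative function on `[0, ∞)` with derivative `-g ≤ 0` is bounded by its initial value,
and `g` is integrable. -/
lemma le_initial_and_integrableOn_of_hasDerivAt_neg {W g : ℝ → ℝ}
    (hW : ∀ t ≥ (0:ℝ), HasDerivAt W (-g t) t) (hW0 : ∀ t ≥ (0:ℝ), 0 ≤ W t)
    (hg : ∀ t ≥ (0:ℝ), 0 ≤ g t) :
    (∀ t ≥ (0:ℝ), W t ≤ W 0) ∧ IntegrableOn g (Ioi 0) := by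
  have hanti : AntitoneOn W (Ici 0) := by
    refine antitoneOn_of_hasDerivWithinAt_nonpos (f' := fun t => -g t) (convex_Ici 0)
      (fun t ht => (hW t ht).continuousAt.continuousWithinAt) ?_ ?_ <;>
    · intro t ht
      rw [interior_Ici] at ht
      first
      | exact (hW t ht.le).hasDerivWithinAt
      | exact neg_nonpos.2 (hg t ht.le)
  refine ⟨fun t ht => hanti self_mem_Ici ht ht, ?_⟩
  have hmax : Antitone fun t => W (max 0 t) := fun s t hst =>
    hanti (le_max_left 0 s) (le_max_left 0 t) (max_le_max_left 0 hst)
  have hlim := tendsto_atTop_ciInf hmax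
    ⟨0, by rintro _ ⟨t, rfl⟩; exact hW0 _ (le_max_left 0 t)⟩
  have hlim' := hlim.congr' (f₂ := W) (by
    filter_upwards [eventually_ge_atTop 0] with t ht
    rw [max_eq_right ht])
  have h := integrableOn_Ioi_deriv_of_nonpos (hW 0 le_rfl).continuousAt.continuousWithinAt
    (fun t ht => hW t (le_of_lt ht)) (fun t ht => neg_nonpos.2 (hg t (le_of_lt ht))) hlim'
  simpa using h.neg

/-- Example 1 (estimation laws with smooth limits): for the scalar closed-loop system
`ẋ = -x/2 - (θ̂ - θ)x²`, `θ̂' = γ(x³ + x|x|^{2/r})`. -/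
theorem normalized_estimation_scalar_smooth
    (γ r θ : ℝ) (hγ : 0 < γ) (hr : 1 ≤ r)
    (x θh : ℝ → ℝ)
    (hx : ∀ t ≥ (0:ℝ), HasDerivAt x (-(1/2) * x t - (θh t - θ) * x t ^ 2) t)
    (hθh : ∀ t ≥ (0:ℝ),
      HasDerivAt θh (γ * (x t ^ 3 + x t * |x t| ^ (2/r : ℝ))) t) :
    (∃ C, ∀ t ≥ (0:ℝ), |x t| ≤ C) ∧
    (∃ C, ∀ t ≥ (0:ℝ), |θh t| ≤ C) ∧
    IntegrableOn (fun t => |x t| ^ (2/r : ℝ)) (Ici 0) ∧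
    Tendsto x atTop (nhds 0) := by
  have hp : 0 < 2 / r := by positivity
  set p := 2 / r
  have hxc : ContinuousOn x (Ici 0) := fun t ht => (hx t ht).continuousAt.continuousWithinAt
  have hθc : ContinuousOn θh (Ici 0) := fun t ht => (hθh t ht).continuousAt.continuousWithinAt
  obtain ⟨A, hA, hxA⟩ := exists_primitive_eq_mul_exp
    (x := x) (a := fun t => -(1/2) - (θh t - θ) * x t) (by fun_prop)
    (fun t ht => by convert hx t ht using 1; ring)
  let U : ℝ → ℝ := fun t => |x 0| ^ p * Real.exp (A t * p)
  have hU : ∀ t ≥ (0:ℝ), |x t| ^ p = U t := by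
    intro t ht
    rw [hxA t ht, abs_mul, Real.abs_exp, Real.mul_rpow (abs_nonneg _) (Real.exp_pos _).le,
      ← Real.exp_mul]
  have hU0 : ∀ t, 0 ≤ U t := fun t => by positivity
  have hU' : ∀ t ≥ (0:ℝ), HasDerivAt U (U t * ((-(1/2) - (θh t - θ) * x t) * p)) t := by
    intro t ht
    refine (((hA t ht).mul_const p).exp.const_mul (|x 0| ^ p)).congr_deriv ?_
    simp only [U]
    ring
  have hUc : ContinuousOn U (Ici 0) := fun t ht => (hU' t ht).continuousAt.continuousWithinAt
  let W : ℝ → ℝ := fun t => x t ^ 2 / 2 + U t / p + (θh t - θ) ^ 2 / (2 * γ)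
  have hW : ∀ t ≥ (0:ℝ), HasDerivAt W (-((x t ^ 2 + U t) / 2)) t := by
    intro t ht
    have hθt := hθh t ht
    rw [hU t ht] at hθt
    refine (((((hx t ht).pow 2).div_const 2).add ((hU' t ht).div_const p)).add
      (((hθt.sub_const θ).pow 2).div_const (2 * γ))).congr_deriv ?_
    field_simp
    ring
  have hW0 : ∀ t, 0 ≤ W t := fun t => by have := hU0 t; positivity
  obtain ⟨hWle, hint⟩ := le_initial_and_integrableOn_of_hasDerivAt_neg hW (fun t _ => hW0 t)
    (fun t _ => by have := hU0 t; positivity)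
  have hxb : ∀ t ≥ (0:ℝ), |x t| ≤ √(2 * W 0) := by
    intro t ht
    apply Real.abs_le_sqrt
    have h1 : 0 ≤ U t / p := div_nonneg (hU0 t) hp.le
    have h2 : 0 ≤ (θh t - θ) ^ 2 / (2 * γ) := by positivity
    linarith [hWle t ht, show W t = x t ^ 2 / 2 + U t / p + (θh t - θ) ^ 2 / (2 * γ) from rfl]
  have hzb : ∀ t ≥ (0:ℝ), |θh t - θ| ≤ √(2 * γ * W 0) := by
    intro t ht
    apply Real.abs_le_sqrt
    have h1 : 0 ≤ U t / p := div_nonneg (hU0 t) hp.le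
    have h2 : (θh t - θ) ^ 2 / (2 * γ) ≤ W 0 := by
      linarith [hWle t ht, sq_nonneg (x t),
        show W t = x t ^ 2 / 2 + U t / p + (θh t - θ) ^ 2 / (2 * γ) from rfl]
    rwa [div_le_iff₀' (by positivity)] at h2
  have hUint : IntegrableOn U (Ioi 0) := by
    refine (hint.const_mul 2).mono'
      ((hUc.mono Ioi_subset_Ici_self).aestronglyMeasurable measurableSet_Ioi) (ae_of_all _ ?_)
    intro t
    rw [Real.norm_of_nonneg (hU0 t)]
    linarith [sq_nonneg (x t)]
  have hxint : IntegrableOn (fun t => x t ^ 2) (Ioi 0) := by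
    refine (hint.const_mul 2).mono'
      (((hxc.pow 2).mono Ioi_subset_Ici_self).aestronglyMeasurable measurableSet_Ioi)
      (ae_of_all _ ?_)
    intro t
    rw [Real.norm_of_nonneg (sq_nonneg (x t))]
    linarith [hU0 t]
  refine ⟨⟨_, hxb⟩, ⟨√(2 * γ * W 0) + |θ|, fun t ht => ?_⟩, ?_, ?_⟩
  · linarith [hzb t ht, abs_sub_abs_le_abs_sub (θh t) θ]
  · rw [integrableOn_Ici_iff_integrableOn_Ioi]
    exact hUint.congr_fun (fun t ht => (hU t (le_of_lt ht)).symm) measurableSet_Ioi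
  · have hsq' : ∀ t ∈ Ioi (0:ℝ), HasDerivAt (fun t => x t ^ 2)
        ((-1 - 2 * ((θh t - θ) * x t)) * x t ^ 2) t := by
      intro t ht
      refine ((hx t (le_of_lt ht)).pow 2).congr_deriv ?_
      ring
    have hderiv : IntegrableOn (fun t => (-1 - 2 * ((θh t - θ) * x t)) * x t ^ 2) (Ioi 0) := by
      refine (hxint.const_mul (1 + 2 * (√(2 * γ * W 0) * √(2 * W 0)))).mono'
        (ContinuousOn.aestronglyMeasurable ?_ measurableSet_Ioi) ?_
      · exact ContinuousOn.mono (s := Ici 0) (by fun_prop) Ioi_subset_Ici_self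
      · refine ae_restrict_of_forall_mem measurableSet_Ioi fun t ht => ?_
        rw [norm_mul, Real.norm_of_nonneg (sq_nonneg (x t)), Real.norm_eq_abs]
        gcongr
        have h : |(θh t - θ) * x t| ≤ √(2 * γ * W 0) * √(2 * W 0) := by
          rw [abs_mul]
          gcongr
          · exact hzb t (le_of_lt ht)
          · exact hxb t (le_of_lt ht)
        rw [abs_le] at h ⊢
        constructor <;> linarith
    have hlim := tendsto_zero_of_hasDerivAt_of_integrableOn_Ioi hsq' hderiv hxint
    have hsqrt := hlim.sqrt
    simp only [Real.sqrt_sq_eq_abs, Real.sqrt_zero] at hsqrt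
    exact (tendsto_zero_iff_abs_tendsto_zero _).2 hsqrt
end

section
/- Let γ > 0, r ≥ 1 and θ ∈ ℝ. Let x, θ̂ : [0,∞) → ℝ be differentiable functions satisfying, for all t ≥ 0: x'(t) = −(1/2)x(t) − (θ̂(t) − θ)|x(t)| and θ̂'(t) = γ sign(x(t)) (x(t)² + |x(t)|^{2/r}). Define Q(t) = x(t)² + r|x(t)|^{2/r} + (1/γ)(θ̂(t) − θ)². Then at every t ≥ 0 with x(t) ≠ 0, the function Q is differentiable at t and Q'(t) ≤ −x(t)² − |x(t)|^{2/r}. -/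
open MeasureTheory Set Filter

/-- The key dissipation inequality in the proof of Proposition 1:
with `Q = x² + r|x|^{2/r} + (θ̂-θ)²/γ`, at every time with `x(t) ≠ 0` one has
`Q'(t) ≤ -x(t)² - |x(t)|^{2/r}`. -/
theorem dissipation_inequality_scalar
    (γ r θ : ℝ) (hγ : 0 < γ) (hr : 1 ≤ r)
    (x θh : ℝ → ℝ)
    (hx : ∀ t ≥ (0:ℝ), HasDerivAt x (-(1/2) * x t - (θh t - θ) * |x t|) t)
    (hθh : ∀ t ≥ (0:ℝ),
      HasDerivAt θh (γ * Real.sign (x t) * (x t ^ 2 + |x t| ^ (2/r : ℝ))) t) :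
    ∀ t ≥ (0:ℝ), x t ≠ 0 → ∃ q,
      HasDerivAt (fun s => x s ^ 2 + r * |x s| ^ (2/r : ℝ) + (1/γ) * (θh s - θ) ^ 2) q t ∧
      q ≤ -x t ^ 2 - |x t| ^ (2/r : ℝ) := by
  intro t ht hxt
  have habs : HasDerivAt (fun s => |x s|)
      (Real.sign (x t) * (-(1/2) * x t - (θh t - θ) * |x t|)) t := by
    have h := (hasDerivAt_abs hxt).comp t (hx t ht)
    rcases hxt.lt_or_gt with hneg | hpos
    · simpa [Function.comp_def, Real.sign_of_neg hneg, sign_neg hneg] using h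
    · simpa [Function.comp_def, Real.sign_of_pos hpos, sign_pos hpos] using h
  have hpow := (habs.rpow_const (p := 2/r) (Or.inl (abs_ne_zero.mpr hxt))).const_mul r
  have hQ := (((hx t ht).pow 2).add hpow).add ((((hθh t ht).sub_const θ).pow 2).const_mul (1/γ))
  refine ⟨_, hQ, le_of_eq ?_⟩
  have hr0 : r ≠ 0 := by positivity
  have hγ0 : γ ≠ 0 := hγ.ne'
  have hmul : |x t| ^ (2/r : ℝ) = |x t| ^ (2/r - 1 : ℝ) * |x t| := by
    rw [Real.rpow_sub_one (abs_ne_zero.mpr hxt), div_mul_cancel₀ _ (abs_ne_zero.mpr hxt)]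
  rw [hmul]
  generalize |x t| ^ (2/r - 1 : ℝ) = P
  rcases hxt.lt_or_gt with hneg | hpos
  · rw [Real.sign_of_neg hneg, abs_of_neg hneg]
    push_cast
    field_simp
    ring
  · rw [Real.sign_of_pos hpos, abs_of_pos hpos]
    push_cast
    field_simp
    ring
end

section
/- Under the hypotheses (i)–(iv) of the normalized-estimation-law theorem — namely: V : ℝⁿ × ℝᵖ → ℝ continuously differentiable with c₁‖x‖₂² ≤ V(x,ϑ) ≤ c₂‖x‖₂²; f, B, Δ continuous; λ, ε, r > 0; Γ symmetric positive definite; ω continuously differentiable with ω > 0, ω' > 0; differentiable trajectories x(t) ≠ 0, θ̂(t), ρ(t) and an input u(t) satisfying x' = f(x) + Δ(x)ᵀθ + B(x)u, the control inequality ⟨∇ₓV(x,θ̂), f(x) + Δ(x)ᵀθ̂ + B(x)u⟩ ≤ −λV(x,θ̂), the estimation law θ̂' = ω(ρ) V(x,θ̂)^{1/r−1} Γ Δ(x) ∇ₓV(x,θ̂), and the gain law ρ' = −[ω(ρ) V(x,θ̂)^{1/r−1}/(ω'(ρ)(rV(x,θ̂)^{1/r} + ε))] ⟨∇_ϑV(x,θ̂),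 θ̂'⟩ — the function Q(t) = ω(ρ(t)) (r V(x(t),θ̂(t))^{1/r} + ε) + (1/2)(θ̂(t) − θ)ᵀ Γ⁻¹ (θ̂(t) − θ) is differentiable and satisfies Q'(t) ≤ −λ ω(ρ(t)) V(x(t),θ̂(t))^{1/r} for all t ≥ 0. Consequently Q is nonincreasing and ∫₀^∞ λ ω(ρ(t)) V(x(t),θ̂(t))^{1/r} dt ≤ Q(0) < ∞. -/
open Matrix MeasureTheory Set Filter Topology

/-- The derivative of a quadratic form with symmetric matrix along a differentiable curve. -/
theorem hasDerivAt_half_quadraticForm {p : ℕ} {M : Matrix (Fin p) (Fin p) ℝ} (hM : Mᵀ = M)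
    {z : ℝ → Fin p → ℝ} {z' : Fin p → ℝ} {t : ℝ} (hz : HasDerivAt z z' t) :
    HasDerivAt (fun s => (1/2) * (z s ⬝ᵥ M.mulVec (z s))) (z t ⬝ᵥ M.mulVec z') t := by
  have hzi : ∀ i, HasDerivAt (fun s => z s i) (z' i) t := hasDerivAt_pi.1 hz
  have hMz : ∀ i, HasDerivAt (fun s => M.mulVec (z s) i) (M.mulVec z' i) t := by
    intro i
    simp only [Matrix.mulVec, dotProduct]
    exact HasDerivAt.fun_sum fun j _ => (hzi j).const_mul (M i j)
  have h : HasDerivAt (fun s => z s ⬝ᵥ M.mulVec (z s))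
      (z' ⬝ᵥ M.mulVec (z t) + z t ⬝ᵥ M.mulVec z') t := by
    simp only [dotProduct, ← Finset.sum_add_distrib]
    exact HasDerivAt.fun_sum fun i _ => (hzi i).mul (hMz i)
  have hsymm : z' ⬝ᵥ M.mulVec (z t) = z t ⬝ᵥ M.mulVec z' := by
    rw [dotProduct_mulVec, ← mulVec_transpose, hM, dotProduct_comm]
  refine (h.const_mul (1/2 : ℝ)).congr_deriv ?_
  rw [hsymm]
  ring

/-- The chain rule for a function of two variables, in terms of its partial gradients. -/
theorem hasDerivAt_comp_of_partial_gradients {n p : ℕ} {V : (Fin n → ℝ) → (Fin p → ℝ) → ℝ}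
    {x : ℝ → Fin n → ℝ} {y : ℝ → Fin p → ℝ} {x' : Fin n → ℝ} {y' : Fin p → ℝ} {t : ℝ}
    {a : Fin n → ℝ} {b : Fin p → ℝ}
    (hV : DifferentiableAt ℝ (fun q : (Fin n → ℝ) × (Fin p → ℝ) => V q.1 q.2) (x t, y t))
    (ha : ∀ v, fderiv ℝ (fun ξ => V ξ (y t)) (x t) v = a ⬝ᵥ v)
    (hb : ∀ w, fderiv ℝ (fun ϑ => V (x t) ϑ) (y t) w = b ⬝ᵥ w)
    (hx : HasDerivAt x x' t) (hy : HasDerivAt y y' t) :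
    HasDerivAt (fun s => V (x s) (y s)) (a ⬝ᵥ x' + b ⬝ᵥ y') t := by
  have hL := hV.hasFDerivAt
  set L := fderiv ℝ (fun q : (Fin n → ℝ) × (Fin p → ℝ) => V q.1 q.2) (x t, y t)
  have h1 : HasFDerivAt (fun ξ => V ξ (y t)) (L.comp (.inl ℝ _ _)) (x t) :=
    HasFDerivAt.comp (x t) (f := fun ξ => (ξ, y t)) hL (hasFDerivAt_prodMk_left (x t) (y t))
  have h2 : HasFDerivAt (fun ϑ => V (x t) ϑ) (L.comp (.inr ℝ _ _)) (y t) :=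
    HasFDerivAt.comp (y t) (f := fun ϑ => (x t, ϑ)) hL (hasFDerivAt_prodMk_right (x t) (y t))
  have h : HasDerivAt (fun s => V (x s) (y s)) (L (x', y')) t :=
    HasFDerivAt.comp_hasDerivAt (f := fun s => (x s, y s)) t hL (hx.prodMk hy)
  convert h using 1
  rw [← ha, ← hb, h1.fderiv, h2.fderiv]
  simp [← map_add]

/-- A nonnegative function whose derivative on `[0, ∞)` is at most `-g` for a nonnegative
continuous `g` is nonincreasing, and its initial value bounds the integral of `g`. -/
theorem antitoneOn_and_integral_le_of_hasDerivAt_le_neg {Q Q' g : ℝ → ℝ}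
    (hQ : ∀ t ≥ (0:ℝ), HasDerivAt Q (Q' t) t) (hQ' : ∀ t ≥ (0:ℝ), Q' t ≤ -g t)
    (hg : ContinuousOn g (Ici 0)) (hg0 : ∀ t ≥ (0:ℝ), 0 ≤ g t) (hQ0 : ∀ t ≥ (0:ℝ), 0 ≤ Q t) :
    AntitoneOn Q (Ici 0) ∧ IntegrableOn g (Ici 0) ∧ ∫ t in Ici (0:ℝ), g t ≤ Q 0 := by
  have hint : ∀ T : ℝ, IntegrableOn g (Icc 0 T) := fun T =>
    (hg.mono Icc_subset_Ici_self).integrableOn_Icc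
  have hbound : ∀ T ≥ (0:ℝ), ∫ t in (0:ℝ)..T, g t ≤ Q 0 := by
    intro T hT
    have h := intervalIntegral.sub_le_integral_of_hasDeriv_right_of_le hT
      (fun t ht => (hQ t ht.1).continuousAt.continuousWithinAt)
      (fun t ht => (hQ t ht.1.le).hasDerivWithinAt) (hint T).neg
      (fun t ht => hQ' t ht.1.le)
    simp only [Pi.neg_apply, intervalIntegral.integral_neg] at h
    linarith [hQ0 T hT]
  have hgi : IntegrableOn g (Ioi 0) := by
    refine integrableOn_Ioi_of_intervalIntegral_norm_bounded (Q 0) 0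
      (fun T => (hint T).mono_set Ioc_subset_Icc_self) tendsto_id ?_
    filter_upwards [eventually_ge_atTop 0] with T hT
    refine le_trans (le_of_eq (intervalIntegral.integral_congr fun t ht => ?_)) (hbound T hT)
    rw [uIcc_of_le hT] at ht
    exact Real.norm_of_nonneg (hg0 t ht.1)
  refine ⟨?_, (integrableOn_Ici_iff_integrableOn_Ioi).2 hgi, ?_⟩
  · refine antitoneOn_of_deriv_nonpos (convex_Ici 0)
      (fun t ht => (hQ t ht).continuousAt.continuousWithinAt)
      (fun t ht => (hQ t (interior_subset ht)).differentiableAt.differentiableWithinAt)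
      fun t ht => ?_
    have ht0 : t ≥ 0 := interior_subset ht
    rw [(hQ t ht0).deriv]
    linarith [hQ' t ht0, hg0 t ht0]
  · rw [integral_Ici_eq_integral_Ioi]
    refine le_of_tendsto (intervalIntegral_tendsto_integral_Ioi 0 hgi tendsto_id) ?_
    filter_upwards [eventually_ge_atTop 0] with T hT using hbound T hT

/-- The central dissipation inequality in the proof of the normalized estimation law
theorem: `Q(t) = ω(ρ)(rV^{1/r} + ε) + (1/2)(θ̂-θ)ᵀΓ⁻¹(θ̂-θ)` is differentiable with
`Q' ≤ -λ ω(ρ) V^{1/r}`; hence `Q` is nonincreasing and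
`∫₀^∞ λ ω(ρ) V^{1/r} ≤ Q(0) < ∞`. -/
theorem normalized_estimation_dissipation
    {n m p : ℕ} (hn : 0 < n) (hm : 0 < m) (hp : 0 < p)
    (c₁ c₂ lam ε r : ℝ)
    (hc₁ : 0 < c₁) (hc₂ : 0 < c₂) (hlam : 0 < lam) (hε : 0 < ε) (hr : 0 < r)
    (Γ : Matrix (Fin p) (Fin p) ℝ) (hΓ : Γ.PosDef)
    (θ : Fin p → ℝ)
    (ω ω' : ℝ → ℝ) (hωderiv : ∀ s, HasDerivAt ω (ω' s) s) (hω'cont : Continuous ω')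
    (hωpos : ∀ s, 0 < ω s) (hω'pos : ∀ s, 0 < ω' s)
    (f : (Fin n → ℝ) → (Fin n → ℝ)) (hf : Continuous f)
    (B : (Fin n → ℝ) → Matrix (Fin n) (Fin m) ℝ) (hB : Continuous B)
    (Δ : (Fin n → ℝ) → Matrix (Fin p) (Fin n) ℝ) (hΔ : Continuous Δ)
    (V : (Fin n → ℝ) → (Fin p → ℝ) → ℝ)
    (hV : ContDiff ℝ 1 (fun q : (Fin n → ℝ) × (Fin p → ℝ) => V q.1 q.2))
    (gx : (Fin n → ℝ) → (Fin p → ℝ) → (Fin n → ℝ))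
    (gθ : (Fin n → ℝ) → (Fin p → ℝ) → (Fin p → ℝ))
    (hgx : ∀ (x : Fin n → ℝ) (ϑ : Fin p → ℝ) (v : Fin n → ℝ),
      fderiv ℝ (fun y => V y ϑ) x v = gx x ϑ ⬝ᵥ v)
    (hgθ : ∀ (x : Fin n → ℝ) (ϑ : Fin p → ℝ) (w : Fin p → ℝ),
      fderiv ℝ (fun ϑ' => V x ϑ') ϑ w = gθ x ϑ ⬝ᵥ w)
    (hVbound : ∀ (x : Fin n → ℝ) (ϑ : Fin p → ℝ),
      c₁ * (∑ i, x i ^ 2) ≤ V x ϑ ∧ V x ϑ ≤ c₂ * (∑ i, x i ^ 2))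
    (x : ℝ → Fin n → ℝ) (θh : ℝ → Fin p → ℝ) (ρ : ℝ → ℝ) (u : ℝ → Fin m → ℝ)
    (x' : ℝ → Fin n → ℝ) (θh' : ℝ → Fin p → ℝ) (ρ' : ℝ → ℝ)
    (hx : ∀ t ≥ (0:ℝ), HasDerivAt x (x' t) t)
    (hθh : ∀ t ≥ (0:ℝ), HasDerivAt θh (θh' t) t)
    (hρ : ∀ t ≥ (0:ℝ), HasDerivAt ρ (ρ' t) t)
    (hxne : ∀ t ≥ (0:ℝ), x t ≠ 0)
    (hode : ∀ t ≥ (0:ℝ),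
      x' t = f (x t) + ((Δ (x t))ᵀ).mulVec θ + (B (x t)).mulVec (u t))
    (hctrl : ∀ t ≥ (0:ℝ),
      gx (x t) (θh t) ⬝ᵥ
          (f (x t) + ((Δ (x t))ᵀ).mulVec (θh t) + (B (x t)).mulVec (u t))
        ≤ -lam * V (x t) (θh t))
    (hest : ∀ t ≥ (0:ℝ), θh' t =
      (ω (ρ t) * V (x t) (θh t) ^ (1/r - 1 : ℝ)) •
        Γ.mulVec ((Δ (x t)).mulVec (gx (x t) (θh t))))
    (hgain : ∀ t ≥ (0:ℝ), ρ' t =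
      -(ω (ρ t) * V (x t) (θh t) ^ (1/r - 1 : ℝ) /
          (ω' (ρ t) * (r * V (x t) (θh t) ^ (1/r : ℝ) + ε))) *
        (gθ (x t) (θh t) ⬝ᵥ θh' t)) :
    (∃ Q' : ℝ → ℝ,
      (∀ t ≥ (0:ℝ),
        HasDerivAt (fun s =>
          ω (ρ s) * (r * V (x s) (θh s) ^ (1/r : ℝ) + ε) +
            (1/2) * ((θh s - θ) ⬝ᵥ Γ⁻¹.mulVec (θh s - θ))) (Q' t) t) ∧
      (∀ t ≥ (0:ℝ), Q' t ≤ -(lam * ω (ρ t) * V (x t) (θh t) ^ (1/r : ℝ)))) ∧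
    AntitoneOn (fun s =>
      ω (ρ s) * (r * V (x s) (θh s) ^ (1/r : ℝ) + ε) +
        (1/2) * ((θh s - θ) ⬝ᵥ Γ⁻¹.mulVec (θh s - θ))) (Ici 0) ∧
    IntegrableOn (fun t => lam * ω (ρ t) * V (x t) (θh t) ^ (1/r : ℝ)) (Ici 0) ∧
    ∫ t in Ici (0:ℝ), lam * ω (ρ t) * V (x t) (θh t) ^ (1/r : ℝ) ≤
      ω (ρ 0) * (r * V (x 0) (θh 0) ^ (1/r : ℝ) + ε) +
        (1/2) * ((θh 0 - θ) ⬝ᵥ Γ⁻¹.mulVec (θh 0 - θ)) := by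
  have hVpos : ∀ t ≥ (0:ℝ), 0 < V (x t) (θh t) := by
    intro t ht
    refine lt_of_lt_of_le (mul_pos hc₁ ?_) (hVbound (x t) (θh t)).1
    obtain ⟨i, hi⟩ := Function.ne_iff.1 (hxne t ht)
    exact Finset.sum_pos' (fun j _ => sq_nonneg _) ⟨i, Finset.mem_univ i, sq_pos_of_ne_zero hi⟩
  have hΓsymm : (Γ⁻¹)ᵀ = Γ⁻¹ := by
    simpa [IsHermitian, conjTranspose_eq_transpose_of_trivial] using hΓ.inv.isHermitian
  have hVderiv : ∀ t ≥ (0:ℝ), HasDerivAt (fun s => V (x s) (θh s))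
      (gx (x t) (θh t) ⬝ᵥ x' t + gθ (x t) (θh t) ⬝ᵥ θh' t) t := fun t ht =>
    hasDerivAt_comp_of_partial_gradients (hV.differentiable one_ne_zero _)
      (hgx _ _) (hgθ _ _) (hx t ht) (hθh t ht)
  have hQ : ∀ t ≥ (0:ℝ), HasDerivAt (fun s =>
      ω (ρ s) * (r * V (x s) (θh s) ^ (1/r : ℝ) + ε) +
        (1/2) * ((θh s - θ) ⬝ᵥ Γ⁻¹.mulVec (θh s - θ)))
      (ω (ρ t) * V (x t) (θh t) ^ (1/r - 1 : ℝ) *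
        (gx (x t) (θh t) ⬝ᵥ
          (f (x t) + ((Δ (x t))ᵀ).mulVec (θh t) + (B (x t)).mulVec (u t)))) t := by
    intro t ht
    have hρω : HasDerivAt (fun s => ω (ρ s)) (ω' (ρ t) * ρ' t) t :=
      (hωderiv (ρ t)).comp t (hρ t ht)
    have hpow := (((hVderiv t ht).rpow_const (p := 1/r) (Or.inl (hVpos t ht).ne')).const_mul
      r).add_const ε
    have hquad := hasDerivAt_half_quadraticForm hΓsymm ((hθh t ht).sub_const θ)
    refine ((hρω.mul hpow).add hquad).congr_deriv ?_
    have hW : 0 < r * V (x t) (θh t) ^ (1/r : ℝ) + ε := by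
      have := Real.rpow_pos_of_pos (hVpos t ht) (1/r)
      positivity
    have hgain' : ω' (ρ t) * ρ' t * (r * V (x t) (θh t) ^ (1/r : ℝ) + ε) =
        -(ω (ρ t) * V (x t) (θh t) ^ (1/r - 1 : ℝ) * (gθ (x t) (θh t) ⬝ᵥ θh' t)) := by
      have := (hω'pos (ρ t)).ne'
      have := hW.ne'
      rw [hgain t ht]
      generalize r * V (x t) (θh t) ^ (1/r : ℝ) + ε = W at *
      field_simp
    have hquad' : (θh t - θ) ⬝ᵥ Γ⁻¹.mulVec (θh' t) =
        ω (ρ t) * V (x t) (θh t) ^ (1/r - 1 : ℝ) *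
          (gx (x t) (θh t) ⬝ᵥ ((Δ (x t))ᵀ).mulVec (θh t - θ)) := by
      rw [hest t ht, mulVec_smul, mulVec_mulVec _ Γ⁻¹ Γ,
        nonsing_inv_mul _ ((isUnit_iff_isUnit_det _).1 hΓ.isUnit), one_mulVec, dotProduct_smul,
        smul_eq_mul, mulVec_transpose, dotProduct_mulVec, dotProduct_comm (gx _ _)]
    rw [hgain', hquad', hode t ht, mulVec_sub]
    simp only [dotProduct_add, dotProduct_sub]
    field_simp
    ring
  have hdiss : ∀ t ≥ (0:ℝ), ω (ρ t) * V (x t) (θh t) ^ (1/r - 1 : ℝ) *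
        (gx (x t) (θh t) ⬝ᵥ
          (f (x t) + ((Δ (x t))ᵀ).mulVec (θh t) + (B (x t)).mulVec (u t))) ≤
      -(lam * ω (ρ t) * V (x t) (θh t) ^ (1/r : ℝ)) := by
    intro t ht
    have hpos := mul_pos (hωpos (ρ t)) (Real.rpow_pos_of_pos (hVpos t ht) (1/r - 1))
    refine (mul_le_mul_of_nonneg_left (hctrl t ht) hpos.le).trans_eq ?_
    rw [Real.rpow_sub_one (hVpos t ht).ne']
    have := (hVpos t ht).ne'
    field_simp
  refine ⟨⟨_, hQ, hdiss⟩, antitoneOn_and_integral_le_of_hasDerivAt_le_neg hQ hdiss ?_ ?_ ?_⟩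
  · intro t ht
    exact ((continuousAt_const.mul ((hωderiv (ρ t)).continuousAt.comp (hρ t ht).continuousAt)).mul
      ((hVderiv t ht).continuousAt.rpow_const (Or.inl (hVpos t ht).ne'))).continuousWithinAt
  · intro t ht
    have := hωpos (ρ t)
    have := hVpos t ht
    positivity
  · intro t ht
    have := hωpos (ρ t)
    have := hVpos t ht
    have : 0 ≤ (θh t - θ) ⬝ᵥ Γ⁻¹.mulVec (θh t - θ) := by
      simpa using hΓ.inv.posSemidef.dotProduct_mulVec_nonneg (θh t - θ)
    positivity
end
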